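/- For every integer N and all y, z ∈ K, the bilinear difference equation holds: z·φ_{N+1}(y/q,z/q)·φ_N(y,z) + y·φ_{N+1}(y,z)·φ_N(y/q,z/q) = (y + z)·φ_{N+1}(y,z/q)·φ_N(y/q,z). -/

import Mathlib

open Matrix Finset

/-- The Jacobi--Trudi type determinant: `det (p (n - 2i + j) y z)_{0 ≤ i,j ≤ n-1}`. -/
noncomputable def phiAux {K : Type*} [Field K] (p : ℤ → K → K → K) (n : ℕ) (y z : K) : K :=
  Matrix.det (Matrix.of fun i j : Fin n => p ((n : ℤ) - 2 * ((i : ℕ) : ℤ) + ((j : ℕ) : ℤ)) y z)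

/-- The polynomials `φ_N(y,z)`: for `N ≥ 0` the Jacobi--Trudi determinant (with `φ_0 = 1`
as the empty determinant), and for `N < 0` we set `φ_N = (-1)^(N(N+1)/2) φ_(-N-1)`. -/
noncomputable def phi {K : Type*} [Field K] (p : ℤ → K → K → K) (N : ℤ) (y z : K) : K :=
  if 0 ≤ N then phiAux p N.toNat y z
  else (-1 : K) ^ (N * (N + 1) / 2) * phiAux p (-N - 1).toNat y z

section Plucker

variable {R : Type*} [CommRing R]

/-- The Plücker exchange relation for two square matrices. -/
theorem det_mul_det_exchange {n : Type*} [Fintype n] [DecidableEq n] (A B : Matrix n n R)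
    (r : n) :
    A.det * B.det = ∑ i, (A.updateRow i (B r)).det * (B.updateRow r (A i)).det := by
  have h : A.det • B r = ∑ i, (A.updateRow i (B r)).det • A i := by
    have h1 := Matrix.mulVec_cramer Aᵀ (B r)
    rw [Matrix.det_transpose] at h1
    rw [← h1]
    ext j
    simp [Matrix.mulVec, dotProduct, Matrix.cramer_transpose_apply, mul_comm]
  calc A.det * B.det = (B.updateRow r (A.det • B r)).det := by
        rw [Matrix.det_updateRow_smul, Matrix.updateRow_eq_self]
    _ = ∑ i, (A.updateRow i (B r)).det * (B.updateRow r (A i)).det := by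
        rw [h]
        refine Eq.trans (Matrix.detRowAlternating.map_update_sum _ r _ B) ?_
        exact Finset.sum_congr rfl fun i _ => Matrix.det_updateRow_smul B r _ _

/-- The determinant whose first two rows are `f`, `g`, and whose other rows are those of `v`. -/
def detCons₂ {m : ℕ} (v : Fin m → Fin (m + 2) → R) (f g : Fin (m + 2) → R) : R :=
  Matrix.det (Matrix.of (Fin.cons f (Fin.cons g v) : Fin (m + 2) → Fin (m + 2) → R))

theorem detCons₂_swap {m : ℕ} (v : Fin m → Fin (m + 2) → R) (f g : Fin (m + 2) → R) :
    detCons₂ v g f = -detCons₂ v f g := by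
  have h := Matrix.det_permute (Equiv.swap (0 : Fin (m + 2)) 1)
    (Matrix.of (Fin.cons f (Fin.cons g v) : Fin (m + 2) → Fin (m + 2) → R))
  rw [Equiv.Perm.sign_swap (by simp)] at h
  unfold detCons₂
  rw [show (Matrix.of (Fin.cons g (Fin.cons f v) : Fin (m + 2) → Fin (m + 2) → R)) =
    (Matrix.of (Fin.cons f (Fin.cons g v) : Fin (m + 2) → Fin (m + 2) → R)).submatrix
      (Equiv.swap (0 : Fin (m + 2)) 1) id from ?_, h]
  · simp
  · ext i j
    refine Fin.cases ?_ (fun i => Fin.cases ?_ (fun i => ?_) i) i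
    · rw [Matrix.submatrix_apply, Equiv.swap_apply_left]
      rfl
    · rw [Matrix.submatrix_apply, Fin.succ_zero_eq_one, Equiv.swap_apply_right]
      rfl
    · rw [Matrix.submatrix_apply, Equiv.swap_apply_of_ne_of_ne]
      · simp
      · simp
      · rw [← Fin.succ_zero_eq_one, Ne, Fin.succ_inj]
        simp

/-- The three-term Plücker relation. -/
theorem detCons₂_plucker {m : ℕ} (v : Fin m → Fin (m + 2) → R) (f₁ f₂ f₃ f₄ : Fin (m + 2) → R) :
    detCons₂ v f₁ f₂ * detCons₂ v f₃ f₄ =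
      detCons₂ v f₃ f₂ * detCons₂ v f₁ f₄ + detCons₂ v f₁ f₃ * detCons₂ v f₂ f₄ := by
  have h := det_mul_det_exchange
    (Matrix.of (Fin.cons f₁ (Fin.cons f₂ v) : Fin (m + 2) → Fin (m + 2) → R))
    (Matrix.of (Fin.cons f₃ (Fin.cons f₄ v) : Fin (m + 2) → Fin (m + 2) → R)) 0
  rw [Fin.sum_univ_succ, Fin.sum_univ_succ, Finset.sum_eq_zero, add_zero] at h
  · have key₀ : ∀ a b c : Fin (m + 2) → R,
        (Matrix.of (Fin.cons a (Fin.cons b v) : Fin (m + 2) → Fin (m + 2) → R)).updateRow 0 c =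
          Matrix.of (Fin.cons c (Fin.cons b v) : Fin (m + 2) → Fin (m + 2) → R) := by
      intro a b c
      exact Fin.update_cons_zero (α := fun _ => Fin (m + 2) → R) a _ c
    have key₁ : ∀ a b c : Fin (m + 2) → R,
        (Matrix.of (Fin.cons a (Fin.cons b v) : Fin (m + 2) → Fin (m + 2) → R)).updateRow
          (Fin.succ 0) c =
          Matrix.of (Fin.cons a (Fin.cons c v) : Fin (m + 2) → Fin (m + 2) → R) := by
      intro a b c
      refine Eq.trans (Fin.cons_update (α := fun _ => Fin (m + 2) → R) a _ 0 c).symm ?_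
      exact congrArg _ (Fin.update_cons_zero (α := fun _ => Fin (m + 2) → R) b _ c)
    rw [key₀, key₀, key₁, key₀] at h
    exact h
  · intro i _
    refine mul_eq_zero_of_right _ (Matrix.det_zero_of_row_eq (i := 0) (j := i.succ.succ) ?_ ?_)
    · exact (Fin.succ_ne_zero _).symm
    · rw [Matrix.updateRow_self, Matrix.updateRow_ne (Fin.succ_ne_zero _)]
      rfl

/-- A geometric first row can be cleared by column operations. -/
theorem det_cons_pow {m : ℕ} (c a : R) (w : Fin m → ℕ → R) :
    Matrix.det (Matrix.of (Fin.cons (fun j : Fin (m + 1) => c * a ^ (j : ℕ))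
      (fun i j => w i j) : Fin (m + 1) → Fin (m + 1) → R)) =
      c * Matrix.det (Matrix.of fun i j : Fin m => w i (j + 1) - a * w i j) := by
  rw [Matrix.det_eq_of_forall_col_eq_smul_add_pred (B := Matrix.of
    (Fin.cons (Fin.cons c fun _ => 0)
      (fun i => Fin.cons (w i 0) fun j : Fin m => w i (j + 1) - a * w i j) :
      Fin (m + 1) → Fin (m + 1) → R)) (fun _ => a), Matrix.det_succ_row_zero, Fin.sum_univ_succ]
  · simp [Matrix.submatrix]
  · intro i
    refine Fin.cases ?_ (fun i => ?_) i <;> simp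
  · intro i j
    refine Fin.cases ?_ (fun i => ?_) i
    · simp [pow_succ]; ring
    · simp

theorem detCons₂_pow_pow {m : ℕ} (a b : R) (w : Fin m → ℕ → R) :
    detCons₂ (fun i j => w i j) (fun j => b ^ (j : ℕ)) (fun j => a ^ (j : ℕ)) =
      (a - b) * Matrix.det (Matrix.of fun i j : Fin m =>
        (w i (j + 2) - b * w i (j + 1)) - a * (w i (j + 1) - b * w i j)) := by
  have h := det_cons_pow (m := m + 1) 1 b (Fin.cons (fun k => a ^ k) w)
  rw [one_mul] at h
  refine Eq.trans (Eq.trans ?_ h)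
    (Eq.trans ?_ (det_cons_pow (a - b) a (fun i k => w i (k + 1) - b * w i k)))
  · unfold detCons₂
    congr 1
    ext i j
    refine Fin.cases ?_ (fun i => Fin.cases ?_ (fun i => ?_) i) i <;> simp
  · congr 1
    ext i j
    refine Fin.cases ?_ (fun i => ?_) i
    · simp [pow_succ]; ring
    · simp

theorem detCons₂_single_last_pow {m : ℕ} (a : R) (w : Fin m → ℕ → R) :
    detCons₂ (fun i j => w i j) (Pi.single (Fin.last (m + 1)) 1) (fun j => a ^ (j : ℕ)) =
      (-1) ^ (m + 1) * Matrix.det (Matrix.of fun i j : Fin m => w i (j + 1) - a * w i j) := by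
  have h := det_cons_pow 1 a w
  rw [one_mul] at h
  rw [← h]
  unfold detCons₂
  rw [Matrix.det_succ_row_zero, Fin.sum_univ_castSucc, Finset.sum_eq_zero, zero_add]
  · simp only [of_apply, Fin.cons_zero, Pi.single_eq_same, mul_one, Fin.val_last]
    congr 2
    ext i j
    refine Fin.cases ?_ (fun i => ?_) i <;> simp [Fin.succAbove_last]
  · intro i _
    simp

theorem det_shift_bilinear {m : ℕ} (a b : R) (w : Fin m → ℕ → R) :
    (a - b) * Matrix.det (Matrix.of fun i j : Fin m =>
        (w i (j + 2) - b * w i (j + 1)) - a * (w i (j + 1) - b * w i j)) *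
      Matrix.det (Matrix.of fun i j : Fin m => w i (j + 1)) =
    a * Matrix.det (Matrix.of fun i j : Fin m => w i (j + 2) - a * w i (j + 1)) *
      Matrix.det (Matrix.of fun i j : Fin m => w i (j + 1) - b * w i j) -
    b * Matrix.det (Matrix.of fun i j : Fin m => w i (j + 2) - b * w i (j + 1)) *
      Matrix.det (Matrix.of fun i j : Fin m => w i (j + 1) - a * w i j) := by
  have h := detCons₂_plucker (fun i (j : Fin (m + 2)) => w i j) (fun j => b ^ (j : ℕ))
    (fun j => a ^ (j : ℕ)) (Pi.single (Fin.last (m + 1)) 1) (fun j => 0 ^ (j : ℕ))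
  rw [detCons₂_swap _ (fun j => 0 ^ (j : ℕ)) (fun j => b ^ (j : ℕ)),
    detCons₂_swap _ (fun j => 0 ^ (j : ℕ)) (fun j => a ^ (j : ℕ)),
    detCons₂_swap _ (Pi.single (Fin.last (m + 1)) 1) (fun j => b ^ (j : ℕ))] at h
  simp only [detCons₂_pow_pow, detCons₂_single_last_pow, zero_mul, sub_zero] at h
  have hs : ((-1 : R) ^ (m + 1)) * (-1) ^ (m + 1) = 1 := by
    rw [← mul_pow]; simp
  linear_combination ((-1 : R) ^ (m + 1)) * h - (
    (a - b) * Matrix.det (Matrix.of fun i j : Fin m =>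
        (w i (j + 2) - b * w i (j + 1)) - a * (w i (j + 1) - b * w i j)) *
      Matrix.det (Matrix.of fun i j : Fin m => w i (j + 1)) -
    (a * Matrix.det (Matrix.of fun i j : Fin m => w i (j + 2) - a * w i (j + 1)) *
      Matrix.det (Matrix.of fun i j : Fin m => w i (j + 1) - b * w i j) -
    b * Matrix.det (Matrix.of fun i j : Fin m => w i (j + 2) - b * w i (j + 1)) *
      Matrix.det (Matrix.of fun i j : Fin m => w i (j + 1) - a * w i j))) * hs

end Plucker

section Staircase

variable {R : Type*} [CommRing R]

/-- The staircase Jacobi-Trudi determinant of a sequence. -/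
def staircaseDet (F : ℤ → R) (n : ℕ) : R :=
  Matrix.det (Matrix.of fun i j : Fin n => F ((n : ℤ) - 2 * ((i : ℕ) : ℤ) + ((j : ℕ) : ℤ)))

/-- The coefficients of `(1 - a t) F(t)`. -/
def mulLinear (a : R) (F : ℤ → R) (k : ℤ) : R := F k - a * F (k - 1)

theorem mulLinear_comm (a b : R) (F : ℤ → R) :
    mulLinear a (mulLinear b F) = mulLinear b (mulLinear a F) := by
  funext k
  simp only [mulLinear]
  ring

theorem mulLinear_of_neg {F : ℤ → R} (hF : ∀ k < 0, F k = 0) (a : R) :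
    ∀ k < 0, mulLinear a F k = 0 := by
  intro k hk
  simp [mulLinear, hF k hk, hF (k - 1) (by lia)]

theorem mulLinear_zero {F : ℤ → R} (hF : ∀ k < 0, F k = 0) (hF0 : F 0 = 1) (a : R) :
    mulLinear a F 0 = 1 := by
  simp [mulLinear, hF0, hF (-1) (by lia)]

/-- Staircase determinants are unchanged when the generating function is multiplied by
`1 - a² t²`. -/
theorem staircaseDet_mulLinear_neg_mulLinear {F : ℤ → R} (hF : ∀ k < 0, F k = 0) (a : R)
    (n : ℕ) : staircaseDet (mulLinear (-a) (mulLinear a F)) n = staircaseDet F n := by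
  cases n with
  | zero => simp [staircaseDet]
  | succ n =>
    have h : ∀ G : ℤ → R, (Equiv.Perm.sign (Fin.revPerm (n := n + 1)) : R) *
        staircaseDet G (n + 1) = Matrix.det (Matrix.of fun i j : Fin (n + 1) =>
          G (1 - (n : ℤ) + 2 * ((i : ℕ) : ℤ) + ((j : ℕ) : ℤ))) := by
      intro G
      rw [staircaseDet, ← Matrix.det_permute]
      congr 1
      ext i j
      simp only [submatrix_apply, of_apply, Fin.revPerm_apply, Fin.val_rev, id]
      congr 1
      have := i.isLt
      lia
    have hu : IsUnit (Equiv.Perm.sign (Fin.revPerm (n := n + 1)) : R) := by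
      rcases Int.units_eq_one_or (Equiv.Perm.sign (Fin.revPerm (n := n + 1))) with h | h <;>
        simp [h]
    refine hu.mul_left_cancel ?_
    rw [h, h]
    refine (Matrix.det_eq_of_forall_row_eq_smul_add_pred (fun _ => a ^ 2) ?_ ?_).symm
    · intro j
      have := j.isLt
      simp only [of_apply, mulLinear, Fin.val_zero]
      rw [hF (1 - (n : ℤ) + 2 * ((0 : ℕ) : ℤ) + ((j : ℕ) : ℤ) - 1 - 1) (by push_cast; lia)]
      ring
    · intro i j
      simp only [of_apply, mulLinear, Fin.val_succ, Fin.val_castSucc]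
      rw [show (1 - (n : ℤ) + 2 * (((i : ℕ) + 1 : ℕ) : ℤ) + ((j : ℕ) : ℤ) - 1 - 1) =
        1 - (n : ℤ) + 2 * ((i : ℕ) : ℤ) + ((j : ℕ) : ℤ) by push_cast; ring]
      ring

theorem staircaseDet_eq_det_succ {F : ℤ → R} (hF : ∀ k < 0, F k = 0) (hF0 : F 0 = 1) (n : ℕ) :
    staircaseDet F n = Matrix.det (Matrix.of fun i j : Fin (n + 1) =>
      F ((n : ℤ) - 2 * ((i : ℕ) : ℤ) + ((j : ℕ) : ℤ))) := by
  rw [Matrix.det_succ_row _ (Fin.last n), Fin.sum_univ_castSucc, Finset.sum_eq_zero, zero_add]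
  · have h : (n : ℤ) - 2 * n + n = 0 := by ring
    simp only [of_apply, Fin.val_last, h, hF0, ← two_mul, pow_mul]
    simp [staircaseDet, Matrix.submatrix, Fin.succAbove_last]
  · intro j _
    have := j.isLt
    rw [of_apply, hF _ (by simp only [Fin.val_last, Fin.val_castSucc]; lia)]
    simp

theorem staircaseDet_bilinear_sub {F : ℤ → R} (hF : ∀ k < 0, F k = 0) (hF0 : F 0 = 1) (a b : R)
    (n : ℕ) :
    (a - b) * staircaseDet (mulLinear a (mulLinear b F)) (n + 1) * staircaseDet F n =
      a * staircaseDet (mulLinear a F) (n + 1) * staircaseDet (mulLinear b F) n -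
        b * staircaseDet (mulLinear b F) (n + 1) * staircaseDet (mulLinear a F) n := by
  rw [staircaseDet_eq_det_succ hF hF0,
    staircaseDet_eq_det_succ (mulLinear_of_neg hF a) (mulLinear_zero hF hF0 a) n,
    staircaseDet_eq_det_succ (mulLinear_of_neg hF b) (mulLinear_zero hF hF0 b) n]
  have h := det_shift_bilinear (m := n + 1) a b
    (fun i k => F ((n : ℤ) - 1 - 2 * ((i : ℕ) : ℤ) + (k : ℤ)))
  have e : ∀ (i j : Fin (n + 1)),
      (n : ℤ) - 1 - 2 * ((i : ℕ) : ℤ) + (((j : ℕ) + 2 : ℕ) : ℤ) =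
        ((n + 1 : ℕ) : ℤ) - 2 * ((i : ℕ) : ℤ) + ((j : ℕ) : ℤ) ∧
      (n : ℤ) - 1 - 2 * ((i : ℕ) : ℤ) + (((j : ℕ) + 1 : ℕ) : ℤ) =
        (n : ℤ) - 2 * ((i : ℕ) : ℤ) + ((j : ℕ) : ℤ) ∧
      (n : ℤ) - 1 - 2 * ((i : ℕ) : ℤ) + ((j : ℕ) : ℤ) =
        (n : ℤ) - 2 * ((i : ℕ) : ℤ) + ((j : ℕ) : ℤ) - 1 ∧
      ((n + 1 : ℕ) : ℤ) - 2 * ((i : ℕ) : ℤ) + ((j : ℕ) : ℤ) - 1 =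
        (n : ℤ) - 2 * ((i : ℕ) : ℤ) + ((j : ℕ) : ℤ) := by
    intro i j
    push_cast
    refine ⟨?_, ?_, ?_, ?_⟩ <;> ring
  simp only [fun i j => (e i j).1, fun i j => (e i j).2.1, fun i j => (e i j).2.2.1] at h
  simp only [staircaseDet, mulLinear, fun i j => (e i j).2.2.2]
  exact h

theorem staircaseDet_bilinear {G : ℤ → R} (hG : ∀ k < 0, G k = 0) (hG0 : G 0 = 1) (a b : R)
    (n : ℕ) :
    b * staircaseDet G (n + 1) * staircaseDet (mulLinear a (mulLinear b G)) n +
      a * staircaseDet (mulLinear a (mulLinear b G)) (n + 1) * staircaseDet G n =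
      (a + b) * staircaseDet (mulLinear a G) (n + 1) * staircaseDet (mulLinear b G) n := by
  have h := staircaseDet_bilinear_sub (mulLinear_of_neg hG b) (mulLinear_zero hG hG0 b) a (-b) n
  have h' : mulLinear a (mulLinear (-b) (mulLinear b G)) =
      mulLinear (-b) (mulLinear b (mulLinear a G)) := by
    rw [mulLinear_comm a, mulLinear_comm a]
  rw [h', staircaseDet_mulLinear_neg_mulLinear hG,
    staircaseDet_mulLinear_neg_mulLinear (mulLinear_of_neg hG a),
    staircaseDet_mulLinear_neg_mulLinear hG] at h
  linear_combination -h

end Staircase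

theorem bilinear_bl3
    {K : Type*} [Field K] (q : K) (hq0 : q ≠ 0)
    (hq1 : ∀ k : ℕ, 1 ≤ k → q ^ k ≠ 1)
    (p : ℤ → K → K → K)
    (hp_neg : ∀ k : ℤ, k < 0 → ∀ y z : K, p k y z = 0)
    (hp_zero : ∀ y z : K, p 0 y z = 1)
    (hC1 : ∀ k : ℕ, 1 ≤ k → ∀ y z : K,
      (∑ i ∈ Finset.range k, q ^ i) * p (k : ℤ) y z
        = (y + z + q ^ (k - 1)) * p ((k : ℤ) - 1) y z
          - (1 - q) * y * z * p ((k : ℤ) - 2) y z)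
    (hC2 : ∀ (k : ℤ) (y z : K), p k y (q * z) - p k y z = (q - 1) * z * p (k - 1) y z)
    (hC3 : ∀ (k : ℤ) (y z : K), p k (q * y) z - p k y z = (q - 1) * y * p (k - 1) y z)
    (N : ℤ) (y z : K) :
    z * phi p (N + 1) (y / q) (z / q) * phi p N y z
      + y * phi p (N + 1) y z * phi p N (y / q) (z / q)
    = (y + z) * phi p (N + 1) y (z / q) * phi p N (y / q) z := by
  set a : K := (1 - q) * (y / q) with ha
  set b : K := (1 - q) * (z / q) with hb
  set G : ℤ → K := fun k => p k (y / q) (z / q) with hGdef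
  have hGneg : ∀ k < 0, G k = 0 := fun k hk => hp_neg k hk _ _
  have hG0 : G 0 = 1 := hp_zero _ _
  have hy : ∀ z', (fun k => p k y z') = mulLinear a (fun k => p k (y / q) z') := by
    intro z'
    funext k
    have h := hC3 k (y / q) z'
    rw [mul_div_cancel₀ y hq0] at h
    simp only [mulLinear, ha]
    linear_combination h
  have hz : (fun k => p k (y / q) z) = mulLinear b G := by
    funext k
    have h := hC2 k (y / q) (z / q)
    rw [mul_div_cancel₀ z hq0] at h
    simp only [mulLinear, hb, hGdef]
    linear_combination h
  have e00 : ∀ n, phiAux p n (y / q) (z / q) = staircaseDet G n := fun _ => rfl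
  have e01 : ∀ n, phiAux p n (y / q) z = staircaseDet (mulLinear b G) n := fun n => by
    rw [← hz]; rfl
  have e10 : ∀ n, phiAux p n y (z / q) = staircaseDet (mulLinear a G) n := fun n => by
    rw [hGdef, ← hy]; rfl
  have e11 : ∀ n, phiAux p n y z = staircaseDet (mulLinear a (mulLinear b G)) n := fun n => by
    rw [← hz, ← hy]; rfl
  have hq : (1 - q) / q ≠ 0 :=
    div_ne_zero (sub_ne_zero.2 fun h => hq1 1 le_rfl (by rw [pow_one, ← h])) hq0
  have hab : a = (1 - q) / q * y ∧ b = (1 - q) / q * z := by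
    constructor <;> simp only [ha, hb] <;> ring
  obtain ⟨ha', hb'⟩ := hab
  obtain ⟨n, rfl⟩ | ⟨n, rfl⟩ | rfl : (∃ n : ℕ, N = n) ∨ (∃ n : ℕ, N = -(n : ℤ) - 2) ∨ N = -1 := by
    rcases lt_trichotomy N (-1) with h | h | h
    · exact Or.inr (Or.inl ⟨(-N - 2).toNat, by lia⟩)
    · exact Or.inr (Or.inr h)
    · exact Or.inl ⟨N.toNat, by lia⟩
  · have h0 : ∀ y z, phi p (n : ℤ) y z = phiAux p n y z := fun y z => by simp [phi]
    have h1 : ∀ y z, phi p ((n : ℤ) + 1) y z = phiAux p (n + 1) y z := fun y z => by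
      rw [phi, if_pos (by lia)]
      congr 1
    have h := staircaseDet_bilinear hGneg hG0 a b n
    simp only [h0, h1, e00, e01, e10, e11]
    refine mul_left_cancel₀ hq ?_
    linear_combination h - staircaseDet G (n + 1) *
      staircaseDet (mulLinear a (mulLinear b G)) n * hb' -
      staircaseDet (mulLinear a (mulLinear b G)) (n + 1) * staircaseDet G n * ha' +
      staircaseDet (mulLinear a G) (n + 1) * staircaseDet (mulLinear b G) n * (ha' + hb')
  · obtain ⟨ε, h0⟩ : ∃ ε : K, ∀ y z, phi p (-(n : ℤ) - 2) y z = ε * phiAux p (n + 1) y z :=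
      ⟨_, fun y z => by
        rw [phi, if_neg (by lia), show (-(-(n : ℤ) - 2) - 1).toNat = n + 1 by lia]⟩
    obtain ⟨δ, h1⟩ : ∃ δ : K, ∀ y z, phi p (-(n : ℤ) - 2 + 1) y z = δ * phiAux p n y z :=
      ⟨_, fun y z => by
        rw [phi, if_neg (by lia), show (-(-(n : ℤ) - 2 + 1) - 1).toNat = n by lia]⟩
    have h := staircaseDet_bilinear hGneg hG0 b a n
    rw [mulLinear_comm b a] at h
    simp only [h0, h1, e00, e01, e10, e11]
    refine mul_left_cancel₀ hq ?_
    linear_combination ε * δ * (h - staircaseDet G (n + 1) *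
      staircaseDet (mulLinear a (mulLinear b G)) n * ha' -
      staircaseDet (mulLinear a (mulLinear b G)) (n + 1) * staircaseDet G n * hb' +
      staircaseDet (mulLinear b G) (n + 1) * staircaseDet (mulLinear a G) n * (ha' + hb'))
  · simp [phi, phiAux]
    ring
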